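/- Let 0 < γ < 1 be fixed, let M ≥ 2 be real and let N₁ ≥ 2 be real. Then Σ_{N₁ < n ≤ 2N₁} min(1, 1/(M‖n^γ‖)) ≪ ( N₁ M^{−1} + N₁^{γ/2} M^{1/2} + N₁^{1−γ/2} M^{−1/2} ) log M, where the sum is over integers n with N₁ < n ≤ 2N₁ and the implied constant depends only on γ. -/

import Mathlib

/-- `nint x` is the distance from the real number `x` to the nearest integer. -/
noncomputable def nint (x : ℝ) : ℝ := |x - round x|

open Finset

/-- The additive character `x ↦ exp (2πix)`. -/
noncomputable def unitExp (x : ℝ) : ℂ := Complex.exp ((2 * Real.pi * x : ℝ) * Complex.I)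

lemma norm_unitExp (x : ℝ) : ‖unitExp x‖ = 1 := Complex.norm_exp_ofReal_mul_I _

lemma unitExp_add (x y : ℝ) : unitExp (x + y) = unitExp x * unitExp y := by
  rw [unitExp, unitExp, unitExp, ← Complex.exp_add]
  congr 1
  push_cast
  ring

lemma unitExp_zero : unitExp 0 = 1 := by simp [unitExp]

lemma unitExp_intCast (k : ℤ) : unitExp k = 1 := by
  rw [unitExp, Complex.exp_eq_one_iff]
  exact ⟨k, by push_cast; ring⟩

lemma unitExp_sub_intCast (x : ℝ) (k : ℤ) : unitExp (x - k) = unitExp x := by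
  have h := unitExp_add (x - k) k
  rw [unitExp_intCast, mul_one, sub_add_cancel] at h
  exact h.symm

lemma unitExp_re (x : ℝ) : (unitExp x).re = Real.cos (2 * Real.pi * x) :=
  Complex.exp_ofReal_mul_I_re _

lemma sub_unitExp_mul_cot {φ : ℝ} (hs : Real.sin (Real.pi * φ) ≠ 0) :
    (1 / 2 + Complex.I / 2 * ((Real.cos (Real.pi * φ) / Real.sin (Real.pi * φ) : ℝ) : ℂ)) *
      (1 - unitExp φ) = 1 := by
  have he : unitExp φ = (Real.cos (Real.pi * φ) + Real.sin (Real.pi * φ) * Complex.I) ^ 2 := by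
    rw [Complex.ofReal_cos, Complex.ofReal_sin, ← Complex.exp_mul_I, ← Complex.exp_nat_mul, unitExp]
    congr 1
    push_cast
    ring
  have hsc : (Real.sin (Real.pi * φ) : ℂ) ≠ 0 := by exact_mod_cast hs
  have h1 : (Real.sin (Real.pi * φ) : ℂ) ^ 2 + (Real.cos (Real.pi * φ) : ℂ) ^ 2 = 1 := by
    exact_mod_cast Real.sin_sq_add_cos_sq (Real.pi * φ)
  rw [he]
  set s : ℂ := (Real.sin (Real.pi * φ) : ℂ)
  set c : ℂ := (Real.cos (Real.pi * φ) : ℂ)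
  have hI := Complex.I_sq
  rw [Complex.ofReal_div]
  change (1 / 2 + Complex.I / 2 * (c / s)) * (1 - (c + s * Complex.I) ^ 2) = 1
  field_simp
  linear_combination (2 * s - (s + Complex.I * c)) * h1 +
    (-2 * s * c ^ 2 - s ^ 2 * (s + Complex.I * c)) * hI

lemma two_mul_le_sin_pi_mul {Δ φ : ℝ} (h0 : 0 < Δ) (h1 : Δ ≤ φ) (h2 : φ ≤ 1 - Δ) :
    2 * Δ ≤ Real.sin (Real.pi * φ) := by
  have hpi := Real.pi_pos
  have key : ∀ ψ : ℝ, Δ ≤ ψ → ψ ≤ 1 / 2 → 2 * Δ ≤ Real.sin (Real.pi * ψ) := by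
    intro ψ h3 h4
    have h := Real.mul_le_sin (x := Real.pi * ψ) (by nlinarith) (by nlinarith)
    have : 2 / Real.pi * (Real.pi * ψ) = 2 * ψ := by field_simp
    linarith
  rcases le_total φ (1 / 2) with h | h
  · exact key φ h1 h
  · have := key (1 - φ) (by linarith) (by linarith)
    rwa [mul_sub, mul_one, Real.sin_pi_sub] at this

lemma cot_pi_mul_anti {φ ψ : ℝ} (h0 : 0 < φ) (h1 : φ ≤ ψ) (h2 : ψ < 1) :
    Real.cos (Real.pi * ψ) / Real.sin (Real.pi * ψ) ≤
      Real.cos (Real.pi * φ) / Real.sin (Real.pi * φ) := by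
  have hpi := Real.pi_pos
  have s1 : 0 < Real.sin (Real.pi * φ) := Real.sin_pos_of_pos_of_lt_pi (by positivity) (by nlinarith)
  have s2 : 0 < Real.sin (Real.pi * ψ) := Real.sin_pos_of_pos_of_lt_pi (by nlinarith) (by nlinarith)
  have s3 : 0 ≤ Real.sin (Real.pi * ψ - Real.pi * φ) :=
    Real.sin_nonneg_of_nonneg_of_le_pi (by nlinarith) (by nlinarith)
  rw [Real.sin_sub] at s3
  rw [div_le_div_iff₀ s2 s1]
  linarith

/-- **Kusmin–Landau inequality** (discrete form). -/
lemma norm_sum_unitExp_le_of_antitone {a : ℕ → ℝ} {k : ℤ} {Δ : ℝ} (hΔ : 0 < Δ) (m : ℕ)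
    (h1 : ∀ n ≤ m, Δ ≤ a (n + 1) - a n - k) (h2 : ∀ n ≤ m, a (n + 1) - a n - k ≤ 1 - Δ)
    (hanti : ∀ n < m, a (n + 2) - a (n + 1) ≤ a (n + 1) - a n) :
    ‖∑ n ∈ range (m + 1), unitExp (a n)‖ ≤ 2 / Δ := by
  set φ : ℕ → ℝ := fun n ↦ a (n + 1) - a n - k with hφ
  set t : ℕ → ℝ := fun n ↦ Real.cos (Real.pi * φ n) / Real.sin (Real.pi * φ n) with ht
  set c : ℕ → ℂ := fun n ↦ 1 / 2 + Complex.I / 2 * (t n : ℂ) with hc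
  have hsin : ∀ n ≤ m, 2 * Δ ≤ Real.sin (Real.pi * φ n) := fun n hn ↦
    two_mul_le_sin_pi_mul hΔ (h1 n hn) (h2 n hn)
  have htb : ∀ n ≤ m, |t n| ≤ 1 / (2 * Δ) := by
    intro n hn
    have hs := hsin n hn
    have hs0 : 0 < Real.sin (Real.pi * φ n) := by linarith
    rw [ht, abs_div, abs_of_pos hs0]
    exact div_le_div₀ zero_le_one (Real.abs_cos_le_one _) (by positivity) hs
  have hΔ1 : Δ ≤ 1 / 2 := by
    have := h1 0 (Nat.zero_le _)
    have := h2 0 (Nat.zero_le _)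
    linarith
  have hcb : ∀ n ≤ m, ‖c n‖ ≤ 1 / 2 + 1 / (4 * Δ) := by
    intro n hn
    refine (norm_add_le _ _).trans ?_
    have : ‖Complex.I / 2 * (t n : ℂ)‖ = |t n| / 2 := by
      rw [norm_mul, Complex.norm_real, Real.norm_eq_abs]
      simp
      ring
    rw [this]
    have h4 : 1 / (4 * Δ) = 1 / (2 * Δ) / 2 := by field_simp; norm_num
    have := htb n hn
    rw [h4]
    have h5 : ‖(1 / 2 : ℂ)‖ = 1 / 2 := by norm_num
    rw [h5]
    linarith
  have hE : ∀ n ≤ m, unitExp (a n) = c n * (unitExp (a n) - unitExp (a (n + 1))) := by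
    intro n hn
    have hs0 : Real.sin (Real.pi * φ n) ≠ 0 := by have := hsin n hn; linarith
    have h := sub_unitExp_mul_cot hs0
    have h3 : unitExp (a (n + 1)) = unitExp (a n) * unitExp (φ n) := by
      rw [hφ, unitExp_sub_intCast, ← unitExp_add]
      congr 1
      ring
    rw [h3]
    change c n * (1 - unitExp (φ n)) = 1 at h
    linear_combination -unitExp (a n) * h
  have hind : ∀ j ≤ m, ‖∑ n ∈ range (j + 1), unitExp (a n) + c j * unitExp (a (j + 1))‖ ≤
      ‖c 0‖ + (t j - t 0) / 2 := by
    intro j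
    induction j with
    | zero =>
      intro hj
      have := hE 0 hj
      have h5 : ∑ n ∈ range (0 + 1), unitExp (a n) + c 0 * unitExp (a (0 + 1)) =
          c 0 * unitExp (a 0) := by
        rw [zero_add, sum_range_one]
        linear_combination this
      rw [h5, norm_mul, norm_unitExp]
      simp
    | succ j ih =>
      intro hj
      have := hE (j + 1) hj
      have h5 : ∑ n ∈ range (j + 1 + 1), unitExp (a n) + c (j + 1) * unitExp (a (j + 1 + 1)) =
          (∑ n ∈ range (j + 1), unitExp (a n) + c j * unitExp (a (j + 1))) +
          Complex.I / 2 * ((t (j + 1) - t j : ℝ) : ℂ) * unitExp (a (j + 1)) := by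
        rw [sum_range_succ _ (j + 1)]
        have h6 : c (j + 1) - c j = Complex.I / 2 * ((t (j + 1) - t j : ℝ) : ℂ) := by
          simp only [hc]
          push_cast
          ring
        rw [← h6]
        linear_combination this
      rw [h5]
      refine (norm_add_le _ _).trans ?_
      have hmono : t j ≤ t (j + 1) := by
        refine cot_pi_mul_anti ?_ ?_ ?_
        · have := h1 (j + 1) hj; simp only [hφ]; linarith
        · have := hanti j (by omega); simp only [hφ]; linarith
        · have := h2 j (by omega); simp only [hφ]; linarith
      have h7 : ‖Complex.I / 2 * ((t (j + 1) - t j : ℝ) : ℂ) * unitExp (a (j + 1))‖ =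
          (t (j + 1) - t j) / 2 := by
        rw [norm_mul, norm_mul, norm_unitExp, Complex.norm_real, Real.norm_eq_abs,
          abs_of_nonneg (by linarith)]
        simp
        ring
      rw [h7]
      have := ih (by omega)
      linarith
  have hfin := hind m le_rfl
  have h8 : ‖∑ n ∈ range (m + 1), unitExp (a n)‖ ≤
      ‖∑ n ∈ range (m + 1), unitExp (a n) + c m * unitExp (a (m + 1))‖ + ‖c m‖ := by
    have := norm_sub_le (∑ n ∈ range (m + 1), unitExp (a n) + c m * unitExp (a (m + 1)))
      (c m * unitExp (a (m + 1)))
    rwa [add_sub_cancel_right, norm_mul, norm_unitExp, mul_one] at this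
  have b1 := hcb 0 (Nat.zero_le _)
  have b2 := hcb m le_rfl
  have b3 := abs_le.1 (htb 0 (Nat.zero_le _))
  have b4 := abs_le.1 (htb m le_rfl)
  have e1 : 1 / (4 * Δ) = 1 / Δ / 4 := by field_simp
  have e2 : 1 / (2 * Δ) = 1 / Δ / 2 := by field_simp
  have e3 : 2 ≤ 1 / Δ := by rw [le_div_iff₀ hΔ]; linarith
  rw [e1] at b1 b2
  have e4 : 2 / Δ = 1 / Δ + 1 / Δ := by ring
  rw [e2] at b3 b4
  linarith

lemma card_le_of_sub_le {T : Finset ℕ} {θ : ℕ → ℝ} {μ w : ℝ} (hμ : 0 < μ) (hw : 0 ≤ w)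
    (hθ : ∀ m ∈ T, ∀ n ∈ T, m ≤ n → μ * ((n : ℝ) - m) ≤ θ m - θ n)
    (hT : ∀ m ∈ T, ∀ n ∈ T, θ m - θ n ≤ w) : (#T : ℝ) ≤ w / μ + 1 := by
  rcases T.eq_empty_or_nonempty with rfl | hne
  · simp only [card_empty, Nat.cast_zero]
    positivity
  · have hp := T.min'_mem hne
    have hq := T.max'_mem hne
    have hpq : T.min' hne ≤ T.max' hne := T.min'_le _ hq
    have hsub : T ⊆ Icc (T.min' hne) (T.max' hne) := fun x hx ↦
      mem_Icc.2 ⟨T.min'_le x hx, T.le_max' x hx⟩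
    have hc := card_le_card hsub
    rw [Nat.card_Icc] at hc
    have hc' : (#T : ℝ) ≤ (T.max' hne : ℝ) - T.min' hne + 1 := by
      have : #T + T.min' hne ≤ T.max' hne + 1 := by omega
      have : (#T : ℝ) + T.min' hne ≤ T.max' hne + 1 := by exact_mod_cast this
      linarith
    have h1 := (hθ _ hp _ hq hpq).trans (hT _ hp _ hq)
    have h2 : (T.max' hne : ℝ) - T.min' hne ≤ w / μ := by
      rw [le_div_iff₀ hμ]
      linarith
    linarith

lemma norm_sum_unitExp_le_card (T : Finset ℕ) (a : ℕ → ℝ) :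
    ‖∑ n ∈ T, unitExp (a n)‖ ≤ #T := by
  refine (norm_sum_le _ _).trans ?_
  simp [norm_unitExp]

lemma norm_sum_unitExp_le_of_ordConnected {T : Finset ℕ} (hT : (T : Set ℕ).OrdConnected)
    {a : ℕ → ℝ} {k : ℤ} {Δ : ℝ} (hΔ : 0 < Δ)
    (h1 : ∀ n ∈ T, Δ ≤ a (n + 1) - a n - k) (h2 : ∀ n ∈ T, a (n + 1) - a n - k ≤ 1 - Δ)
    (hanti : ∀ n ∈ T, a (n + 2) - a (n + 1) ≤ a (n + 1) - a n) :
    ‖∑ n ∈ T, unitExp (a n)‖ ≤ 2 / Δ := by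
  rcases T.eq_empty_or_nonempty with rfl | hne
  · simp only [sum_empty, norm_zero]
    positivity
  · have hp := T.min'_mem hne
    have hq := T.max'_mem hne
    obtain ⟨m, hm⟩ := Nat.exists_eq_add_of_le (T.min'_le _ hq)
    set p := T.min' hne
    have hmem : ∀ n ≤ m, p + n ∈ T := fun n hn ↦ by
      have := hT.out (mem_coe.2 hp) (mem_coe.2 hq) ⟨Nat.le_add_right p n, by omega⟩
      exact mem_coe.1 this
    have hTeq : T = (range (m + 1)).image (p + ·) := by
      ext x
      simp only [mem_image, mem_range]
      constructor
      · intro hx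
        have hx1 : p ≤ x := T.min'_le x hx
        have hx2 := T.le_max' x hx
        exact ⟨x - p, by omega, by omega⟩
      · rintro ⟨n, hn, rfl⟩
        exact hmem n (by omega)
    rw [hTeq, sum_image (by intro x _ y _ h; exact Nat.add_left_cancel h)]
    exact norm_sum_unitExp_le_of_antitone (a := fun n ↦ a (p + n)) hΔ m
      (fun n hn ↦ h1 _ (hmem n hn)) (fun n hn ↦ h2 _ (hmem n hn))
      (fun n hn ↦ hanti _ (hmem n hn.le))

/-- **Van der Corput's second derivative test** (discrete form). -/
lemma norm_sum_unitExp_le_of_second_difference {a : ℕ → ℝ} {L : ℕ} {μ K : ℝ} (hμ : 0 < μ)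
    (hK : 1 ≤ K) (h1 : ∀ n < L, μ ≤ (a (n + 1) - a n) - (a (n + 2) - a (n + 1)))
    (h2 : ∀ n < L, (a (n + 1) - a n) - (a (n + 2) - a (n + 1)) ≤ K * μ) :
    ‖∑ n ∈ range L, unitExp (a n)‖ ≤ (K * μ * L + 2) * (6 / √μ) := by
  have hs : 0 < √μ := Real.sqrt_pos.2 hμ
  have hss : √μ * √μ = μ := Real.mul_self_sqrt hμ.le
  rcases lt_or_ge 1 μ with hμ1 | hμ1
  · have h := norm_sum_unitExp_le_card (range L) a
    rw [card_range] at h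
    refine h.trans ?_
    rw [mul_div_assoc', le_div_iff₀ hs]
    have hs1 : √μ ≤ μ := by nlinarith
    have hL : (0 : ℝ) ≤ L := Nat.cast_nonneg L
    have h3 : √μ ≤ K * μ := by nlinarith
    nlinarith [mul_le_mul_of_nonneg_left h3 hL, mul_nonneg hL hs.le]
  set θ : ℕ → ℝ := fun n ↦ a (n + 1) - a n with hθ
  have hlow : ∀ m n, m ≤ n → n ≤ L → μ * ((n : ℝ) - m) ≤ θ m - θ n := by
    intro m n hmn
    induction n, hmn using Nat.le_induction with
    | base => intro _; simp
    | succ n hmn ih =>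
      intro hn
      have := ih (by omega)
      have h3 : μ ≤ θ n - θ (n + 1) := h1 n (by omega)
      push_cast
      linarith
  have hup : ∀ n ≤ L, θ 0 - θ n ≤ K * μ * n := by
    intro n
    induction n with
    | zero => intro _; simp
    | succ n ih =>
      intro hn
      have := ih (by omega)
      have h3 : θ n - θ (n + 1) ≤ K * μ := h2 n (by omega)
      push_cast
      linarith
  have hanti : ∀ m n, m ≤ n → n ≤ L → θ n ≤ θ m := by
    intro m n hmn hn
    have := hlow m n hmn hn
    have h3 : (m : ℝ) ≤ n := by exact_mod_cast hmn
    nlinarith [mul_nonneg hμ.le (sub_nonneg.2 h3)]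
  have hfib : ∀ k : ℤ, ‖∑ n ∈ range L with ⌊θ n⌋ = k, unitExp (a n)‖ ≤ 6 / √μ := by
    intro k
    set S := {n ∈ range L | ⌊θ n⌋ = k} with hS
    have hSmem : ∀ n ∈ S, n < L ∧ (k : ℝ) ≤ θ n ∧ θ n < k + 1 := by
      intro n hn
      rw [hS, mem_filter, mem_range, Int.floor_eq_iff] at hn
      exact hn
    have hSmem' : ∀ n, n < L → (k : ℝ) ≤ θ n → θ n < k + 1 → n ∈ S := by
      intro n hn h3 h4
      rw [hS, mem_filter, mem_range, Int.floor_eq_iff]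
      exact ⟨hn, h3, h4⟩
    have hcount : ∀ T ⊆ S, (∀ m ∈ T, ∀ n ∈ T, θ m - θ n ≤ √μ) → (#T : ℝ) ≤ 2 / √μ := by
      intro T hT hd
      have := card_le_of_sub_le hμ hs.le (fun m _ n hn hmn ↦
        hlow m n hmn (hSmem n (hT hn)).1.le) hd
      refine this.trans ?_
      have h5 : √μ / μ = 1 / √μ := by
        rw [div_eq_div_iff hμ.ne' hs.ne', hss, one_mul]
      have h6 : 1 ≤ 1 / √μ := by
        rw [le_div_iff₀ hs, one_mul]
        exact Real.sqrt_le_one.2 hμ1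
      have h7 : 2 / √μ = 1 / √μ + 1 / √μ := by ring
      linarith
    rw [← sum_filter_add_sum_filter_not S (fun n ↦ θ n - k < √μ),
      ← sum_filter_add_sum_filter_not (S.filter fun n ↦ ¬ θ n - k < √μ)
        (fun n ↦ 1 - √μ < θ n - k)]
    have hA : ‖∑ n ∈ S with θ n - k < √μ, unitExp (a n)‖ ≤ 2 / √μ := by
      refine (norm_sum_unitExp_le_card _ a).trans (hcount _ (filter_subset _ _) ?_)
      intro m hm n hn
      rw [mem_filter] at hm hn
      have := hSmem n hn.1
      linarith
    have hB : ‖∑ n ∈ (S.filter fun n ↦ ¬ θ n - k < √μ) with 1 - √μ < θ n - k, unitExp (a n)‖ ≤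
        2 / √μ := by
      refine (norm_sum_unitExp_le_card _ a).trans
        (hcount _ ((filter_subset _ _).trans (filter_subset _ _)) ?_)
      intro m hm n hn
      rw [mem_filter, mem_filter] at hm hn
      have := hSmem m hm.1.1
      linarith
    have hC : ‖∑ n ∈ (S.filter fun n ↦ ¬ θ n - k < √μ) with ¬ 1 - √μ < θ n - k,
        unitExp (a n)‖ ≤ 2 / √μ := by
      refine norm_sum_unitExp_le_of_ordConnected (k := k) ⟨?_⟩ hs ?_ ?_ ?_
      · intro x hx y hy z hz
        simp only [coe_filter, Set.mem_ofPred_eq, mem_filter] at hx hy ⊢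
        have hyS := hSmem y hy.1.1
        have hxS := hSmem x hx.1.1
        have hzL : z < L := lt_of_le_of_lt hz.2 hyS.1
        have e1 := hanti x z hz.1 hzL.le
        have e2 := hanti z y hz.2 hyS.1.le
        refine ⟨⟨hSmem' z hzL (by linarith) (by linarith), ?_⟩, ?_⟩
        · have := hy.1.2; linarith
        · have := hx.2; linarith
      · intro n hn
        rw [mem_filter, mem_filter] at hn
        exact not_lt.1 hn.1.2
      · intro n hn
        rw [mem_filter, mem_filter] at hn
        exact not_lt.1 hn.2
      · intro n hn
        rw [mem_filter, mem_filter] at hn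
        exact hanti n (n + 1) (by omega) (hSmem n hn.1.1).1
    have e : 6 / √μ = 2 / √μ + (2 / √μ + 2 / √μ) := by ring
    rw [e]
    exact (norm_add_le _ _).trans (add_le_add hA ((norm_add_le _ _).trans (add_le_add hB hC)))
  have hmaps : ∀ n ∈ range L, ⌊θ n⌋ ∈ Icc ⌊θ L⌋ ⌊θ 0⌋ := by
    intro n hn
    rw [mem_range] at hn
    exact mem_Icc.2 ⟨Int.floor_le_floor (hanti n L hn.le le_rfl),
      Int.floor_le_floor (hanti 0 n (Nat.zero_le _) hn.le)⟩
  rw [← sum_fiberwise_of_maps_to hmaps]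
  refine (norm_sum_le _ _).trans ((sum_le_sum fun k _ ↦ hfib k).trans ?_)
  rw [sum_const, nsmul_eq_mul]
  refine mul_le_mul_of_nonneg_right ?_ (by positivity)
  rw [Int.card_Icc]
  have h0L : ⌊θ L⌋ ≤ ⌊θ 0⌋ := Int.floor_le_floor (hanti 0 L (Nat.zero_le _) le_rfl)
  have e1 : (((⌊θ 0⌋ + 1 - ⌊θ L⌋).toNat : ℕ) : ℝ) = (⌊θ 0⌋ : ℝ) + 1 - ⌊θ L⌋ := by
    have : (((⌊θ 0⌋ + 1 - ⌊θ L⌋).toNat : ℕ) : ℤ) = ⌊θ 0⌋ + 1 - ⌊θ L⌋ :=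
      Int.toNat_of_nonneg (by omega)
    exact_mod_cast this
  rw [e1]
  have := Int.floor_le (θ 0)
  have := Int.lt_floor_add_one (θ L)
  have := hup L le_rfl
  linarith

lemma exists_second_difference_rpow {γ x : ℝ} (hx : 0 < x) :
    ∃ y ∈ Set.Ioo x (x + 2), ((x + 1) ^ γ - x ^ γ) - ((x + 2) ^ γ - (x + 1) ^ γ) =
      γ * (1 - γ) * y ^ (γ - 2) := by
  have hd : ∀ (r z : ℝ), 0 < z → HasDerivAt (fun z : ℝ ↦ z ^ r) (r * z ^ (r - 1)) z :=
    fun r z hz ↦ Real.hasDerivAt_rpow_const (Or.inl hz.ne')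
  have hg : ∀ z, 0 < z → HasDerivAt (fun z : ℝ ↦ (z + 1) ^ γ - z ^ γ)
      (γ * (z + 1) ^ (γ - 1) - γ * z ^ (γ - 1)) z := fun z hz ↦
    ((hd γ (z + 1) (by linarith)).comp_add_const z 1).sub (hd γ z hz)
  obtain ⟨ξ, hξ, h1⟩ := exists_hasDerivAt_eq_slope _ _ (show x < x + 1 by linarith)
    (fun z hz ↦ (hg z (by linarith [hz.1])).continuousAt.continuousWithinAt)
    (fun z hz ↦ hg z (by linarith [hz.1]))
  have hξ0 : 0 < ξ := by linarith [hξ.1]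
  obtain ⟨η, hη, h2⟩ := exists_hasDerivAt_eq_slope _ _ (show ξ < ξ + 1 by linarith)
    (fun z hz ↦ (hd (γ - 1) z (by linarith [hz.1])).continuousAt.continuousWithinAt)
    (fun z hz ↦ hd (γ - 1) z (by linarith [hz.1]))
  refine ⟨η, ⟨by linarith [hη.1, hξ.1], by linarith [hη.2, hξ.2]⟩, ?_⟩
  rw [add_sub_cancel_left, div_one] at h1 h2
  rw [show γ - 1 - 1 = γ - 2 by ring] at h2
  rw [show x + 1 + 1 = x + 2 by ring] at h1
  linear_combination h1 + γ * h2

lemma norm_sum_unitExp_rpow_le {γ : ℝ} (hγ1 : 0 < γ) (hγ2 : γ < 1) :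
    ∃ C > 0, ∀ N h : ℝ, 2 ≤ N → 0 < h →
      ‖∑ n ∈ Ioc ⌊N⌋₊ ⌊2 * N⌋₊, unitExp (h * (n : ℝ) ^ γ)‖ ≤
        C * (√h * N ^ (γ / 2) + N ^ (1 - γ / 2) / √h) := by
  set g : ℝ := γ * (1 - γ) / 16 with hg
  have hg0 : 0 < g := by have := sub_pos.2 hγ2; positivity
  have hsg : 0 < √g := Real.sqrt_pos.2 hg0
  refine ⟨192 * √g + 12 / √g, by positivity, fun N h hN hh ↦ ?_⟩
  have hN0 : 0 < N := by linarith
  have hsh : 0 < √h := Real.sqrt_pos.2 hh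
  set μ : ℝ := h * g * N ^ (γ - 2) with hμ
  have hμ0 : 0 < μ := by positivity
  set L := ⌊2 * N⌋₊ - ⌊N⌋₊ with hL
  have hle : ⌊N⌋₊ ≤ ⌊2 * N⌋₊ := Nat.floor_le_floor (by linarith)
  set a : ℕ → ℝ := fun j ↦ h * ((⌊N⌋₊ + 1 + j : ℕ) : ℝ) ^ γ with ha
  have hsum : ∑ n ∈ Ioc ⌊N⌋₊ ⌊2 * N⌋₊, unitExp (h * (n : ℝ) ^ γ) =
      ∑ j ∈ range L, unitExp (a j) := by
    rw [← Ico_add_one_add_one_eq_Ioc, sum_Ico_eq_sum_range]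
    simp only [Nat.add_sub_add_right, ha, hL]
  have hfl : N < ⌊N⌋₊ + 1 := Nat.lt_floor_add_one N
  have hfl2 : (⌊N⌋₊ : ℝ) ≤ N := Nat.floor_le hN0.le
  have hfl3 : (⌊2 * N⌋₊ : ℝ) ≤ 2 * N := Nat.floor_le (by linarith)
  have hLr : (L : ℝ) ≤ 2 * N := by
    rw [hL, Nat.cast_sub hle]
    linarith
  have hsecond : ∀ j < L, μ ≤ (a (j + 1) - a j) - (a (j + 2) - a (j + 1)) ∧
      (a (j + 1) - a j) - (a (j + 2) - a (j + 1)) ≤ 16 * μ := by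
    intro j hj
    set x : ℝ := ((⌊N⌋₊ + 1 + j : ℕ) : ℝ) with hx
    have hx1 : N ≤ x := by rw [hx]; push_cast; have : (0 : ℝ) ≤ j := Nat.cast_nonneg j; linarith
    have hx2 : x ≤ 2 * N := by
      refine le_trans ?_ hfl3
      rw [hx]
      exact_mod_cast (by omega : ⌊N⌋₊ + 1 + j ≤ ⌊2 * N⌋₊)
    obtain ⟨y, hy, hxy⟩ := exists_second_difference_rpow (γ := γ) (x := x) (by linarith)
    have e1 : a (j + 1) = h * (x + 1) ^ γ := by simp only [ha, hx]; push_cast; ring_nf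
    have e2 : a (j + 2) = h * (x + 2) ^ γ := by simp only [ha, hx]; push_cast; ring_nf
    have e0 : a j = h * x ^ γ := rfl
    have e : (a (j + 1) - a j) - (a (j + 2) - a (j + 1)) = 16 * (h * g) * y ^ (γ - 2) := by
      rw [e0, e1, e2, hg]
      linear_combination h * hxy
    have hy1 : y ^ (γ - 2) ≤ N ^ (γ - 2) :=
      Real.rpow_le_rpow_of_nonpos hN0 (by linarith [hy.1]) (by linarith)
    have hy2 : (4 * N) ^ (γ - 2) ≤ y ^ (γ - 2) :=
      Real.rpow_le_rpow_of_nonpos (by linarith [hy.1]) (by linarith [hy.2]) (by linarith)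
    have h16 : (1 / 16 : ℝ) ≤ 4 ^ (γ - 2) := by
      have : (4 : ℝ) ^ (-2 : ℝ) ≤ 4 ^ (γ - 2) :=
        Real.rpow_le_rpow_of_exponent_le (by norm_num) (by linarith)
      refine le_trans (le_of_eq ?_) this
      rw [Real.rpow_neg (by norm_num)]
      norm_num
    rw [Real.mul_rpow (by norm_num) hN0.le] at hy2
    have hhg : 0 < h * g := by positivity
    have hNp : 0 < N ^ (γ - 2) := by positivity
    rw [e, hμ]
    constructor
    · have := mul_le_mul_of_nonneg_right h16 hNp.le
      have h3 := mul_le_mul_of_nonneg_left (this.trans hy2) hhg.le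
      linarith
    · have h3 := mul_le_mul_of_nonneg_left hy1 hhg.le
      linarith
  rw [hsum]
  refine (norm_sum_unitExp_le_of_second_difference (K := 16) hμ0 (by norm_num)
    (fun j hj ↦ (hsecond j hj).1) (fun j hj ↦ (hsecond j hj).2)).trans ?_
  have hX : 0 < N ^ (γ / 2) := by positivity
  have hY : 0 < N ^ (1 - γ / 2) := by positivity
  have hXY : N ^ (1 - γ / 2) * N ^ (γ / 2) = N := by
    rw [← Real.rpow_add hN0, sub_add_cancel, Real.rpow_one]
  have hsμ : √μ = √h * √g / N ^ (1 - γ / 2) := by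
    rw [hμ, Real.sqrt_mul (by positivity), Real.sqrt_mul hh.le, div_eq_mul_inv,
      ← Real.rpow_neg hN0.le, Real.sqrt_eq_rpow (N ^ (γ - 2)), ← Real.rpow_mul hN0.le]
    congr 2
    ring
  have hs0 : 0 < √μ := Real.sqrt_pos.2 hμ0
  have hss : √μ * √μ = μ := Real.mul_self_sqrt hμ0.le
  have h1 : (16 * μ * L + 2) * (6 / √μ) ≤ 192 * (√μ * N) + 12 / √μ := by
    have : ∀ s : ℝ, 0 < s → 192 * (s * N) + 12 / s = (16 * (s * s) * (2 * N) + 2) * (6 / s) := by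
      intro s hs
      field_simp
      ring
    rw [this _ hs0, hss]
    gcongr
  refine h1.trans ?_
  have h2 : √μ * N = √g * (√h * N ^ (γ / 2)) := by
    rw [hsμ]
    nth_rewrite 2 [← hXY]
    field_simp
  have h3 : 12 / √μ = 12 / √g * (N ^ (1 - γ / 2) / √h) := by
    rw [hsμ]
    field_simp
  rw [h2, h3]
  have p1 : 0 < 12 / √g * (√h * N ^ (γ / 2)) := by positivity
  have p2 : 0 < 192 * √g * (N ^ (1 - γ / 2) / √h) := by positivity
  nlinarith

/-- The Dirichlet-type kernel `∑_{k < H} e(kx)`. -/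
noncomputable def expKernel (H : ℕ) (x : ℝ) : ℂ := ∑ k ∈ range H, unitExp (k * x)

lemma norm_expKernel_sq (H : ℕ) (x : ℝ) :
    ‖expKernel H x‖ ^ 2 =
      H + 2 * (∑ j ∈ range H, ∑ d ∈ range j, unitExp (((d + 1 : ℕ) : ℝ) * x)).re := by
  induction H with
  | zero => simp [expKernel]
  | succ H ih =>
    rw [expKernel, sum_range_succ, ← expKernel, sum_range_succ _ H, Complex.add_re,
      ← Complex.normSq_eq_norm_sq, Complex.normSq_add, Complex.normSq_eq_norm_sq, ih,
      Complex.normSq_eq_norm_sq, norm_unitExp]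
    have h : expKernel H x * (starRingEnd ℂ) (unitExp (H * x)) =
        (starRingEnd ℂ) (∑ d ∈ range H, unitExp (((d + 1 : ℕ) : ℝ) * x)) := by
      rw [← sum_range_reflect, expKernel, sum_mul, map_sum]
      refine sum_congr rfl fun k hk ↦ ?_
      rw [mem_range] at hk
      have h1 : H - 1 - k + 1 = H - k := by omega
      have h2 : (H : ℝ) * x = ((H - k : ℕ) : ℝ) * x + k * x := by
        rw [Nat.cast_sub hk.le]
        ring
      rw [h1, h2, unitExp_add, map_mul, mul_comm, mul_assoc, mul_comm _ (unitExp _),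
        Complex.mul_conj, Complex.normSq_eq_norm_sq, norm_unitExp]
      simp
    rw [h, Complex.conj_re]
    push_cast
    ring

lemma sum_norm_expKernel_sq_le (T : Finset ℕ) (f : ℕ → ℝ) (H : ℕ) :
    ∑ n ∈ T, ‖expKernel H (f n)‖ ^ 2 ≤ H * (#T +
      2 * ∑ d ∈ range H, ‖∑ n ∈ T, unitExp (((d + 1 : ℕ) : ℝ) * f n)‖) := by
  simp_rw [norm_expKernel_sq]
  rw [sum_add_distrib, ← mul_sum, ← Complex.re_sum, sum_const, nsmul_eq_mul, sum_comm]
  have h : (∑ j ∈ range H, ∑ n ∈ T, ∑ d ∈ range j, unitExp (((d + 1 : ℕ) : ℝ) * f n)).re ≤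
      H * ∑ d ∈ range H, ‖∑ n ∈ T, unitExp (((d + 1 : ℕ) : ℝ) * f n)‖ := by
    refine (Complex.re_le_norm _).trans ((norm_sum_le _ _).trans ?_)
    rw [← nsmul_eq_mul]
    nth_rewrite 2 [← card_range H]
    refine sum_le_card_nsmul _ _ _ fun j hj ↦ ?_
    rw [sum_comm]
    refine (norm_sum_le _ _).trans (sum_le_sum_of_subset_of_nonneg ?_ fun _ _ _ ↦ norm_nonneg _)
    exact range_subset_range.2 (mem_range.1 hj).le
  linarith

lemma le_norm_expKernel_sq {H : ℕ} {x : ℝ} (h : 8 * H * nint x ≤ 1) :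
    (H : ℝ) ^ 2 / 4 ≤ ‖expKernel H x‖ ^ 2 := by
  have hre : (H : ℝ) / 2 ≤ (expKernel H x).re := by
    rw [expKernel, Complex.re_sum]
    have : ∀ k ∈ range H, (1 / 2 : ℝ) ≤ (unitExp (k * x)).re := by
      intro k hk
      have hk' : (k : ℝ) ≤ H := by exact_mod_cast (mem_range.1 hk).le
      have e : unitExp (k * x) = unitExp (k * (x - round x)) := by
        rw [← unitExp_sub_intCast _ (k * round x)]
        congr 1
        push_cast
        ring
      rw [e, unitExp_re]
      refine le_trans ?_ (Real.one_sub_sq_div_two_le_cos)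
      have h1 : |2 * Real.pi * (k * (x - round x))| ≤ 1 := by
        rw [abs_mul (2 * Real.pi), abs_mul (k : ℝ), Nat.abs_cast, abs_of_pos Real.two_pi_pos]
        change 2 * Real.pi * (k * nint x) ≤ 1
        have h0 : 0 ≤ nint x := abs_nonneg _
        have h2 : k * nint x ≤ 1 / 8 := by nlinarith
        have := Real.pi_lt_d2
        have h3 : 0 ≤ k * nint x := by positivity
        nlinarith
      have := (sq_le_one_iff_abs_le_one _).2 h1
      linarith
    have h2 := card_nsmul_le_sum _ _ _ this
    rw [card_range, nsmul_eq_mul] at h2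
    linarith
  have h3 := hre.trans (Complex.re_le_norm _)
  have h4 : (0 : ℝ) ≤ H / 2 := by positivity
  have := pow_le_pow_left₀ h4 h3 2
  linarith

lemma min_inv_nint_le_sum_expKernel {M : ℝ} (hM : 2 ≤ M) (x : ℝ) :
    (if nint x = 0 then (1 : ℝ) else min 1 (1 / (M * nint x))) ≤
      64 / M * ∑ H ∈ Icc 1 ⌊M⌋₊, ‖expKernel H x‖ ^ 2 / (H : ℝ) ^ 2 := by
  have hM0 : 0 < M := by linarith
  set m := ⌊M⌋₊ with hm
  have hm1 : M / 2 ≤ m := by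
    have := Nat.lt_floor_add_one M
    rw [← hm] at this
    linarith
  have hy0 : 0 ≤ nint x := abs_nonneg _
  have key : ∀ K ≤ m, 8 * K * nint x ≤ 1 →
      (K : ℝ) / 4 ≤ ∑ H ∈ Icc 1 m, ‖expKernel H x‖ ^ 2 / (H : ℝ) ^ 2 := by
    intro K hK h8
    have h1 : ∀ H ∈ Icc 1 K, (1 / 4 : ℝ) ≤ ‖expKernel H x‖ ^ 2 / (H : ℝ) ^ 2 := by
      intro H hH
      rw [mem_Icc] at hH
      have hH0 : (0 : ℝ) < H := by exact_mod_cast hH.1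
      have hHK : (H : ℝ) ≤ K := by exact_mod_cast hH.2
      have := le_norm_expKernel_sq (H := H) (x := x) (by nlinarith)
      rw [le_div_iff₀ (by positivity)]
      linarith
    have h2 := card_nsmul_le_sum _ _ _ h1
    rw [Nat.card_Icc, nsmul_eq_mul, Nat.add_sub_cancel] at h2
    have h3 : ∑ H ∈ Icc 1 K, ‖expKernel H x‖ ^ 2 / (H : ℝ) ^ 2 ≤
        ∑ H ∈ Icc 1 m, ‖expKernel H x‖ ^ 2 / (H : ℝ) ^ 2 :=
      sum_le_sum_of_subset_of_nonneg (Icc_subset_Icc_right hK) fun _ _ _ ↦ by positivity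
    linarith
  rw [div_mul_eq_mul_div, le_div_iff₀ hM0]
  by_cases hfull : 8 * m * nint x ≤ 1
  · have h1 := key m le_rfl hfull
    have h2 : (if nint x = 0 then (1 : ℝ) else min 1 (1 / (M * nint x))) ≤ 1 := by
      split_ifs
      · exact le_rfl
      · exact min_le_left _ _
    nlinarith
  · push Not at hfull
    have hy : 0 < nint x := by
      rcases hy0.eq_or_lt with h | h
      · rw [← h] at hfull
        norm_num at hfull
      · exact h
    rw [if_neg hy.ne']
    have h1 : min 1 (1 / (M * nint x)) * M ≤ 1 / nint x := by
      refine (mul_le_mul_of_nonneg_right (min_le_right _ _) hM0.le).trans (le_of_eq ?_)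
      field_simp
    refine h1.trans ?_
    rcases lt_or_ge (1 / 8) (nint x) with h8 | h8
    · have hm2 : 1 ≤ m := Nat.le_floor (by push_cast; linarith)
      have h2 : ‖expKernel 1 x‖ ^ 2 / ((1 : ℕ) : ℝ) ^ 2 ≤
          ∑ H ∈ Icc 1 m, ‖expKernel H x‖ ^ 2 / (H : ℝ) ^ 2 :=
        single_le_sum (f := fun H : ℕ ↦ ‖expKernel H x‖ ^ 2 / (H : ℝ) ^ 2)
          (fun _ _ ↦ by positivity) (mem_Icc.2 ⟨le_rfl, hm2⟩)
      have h3 : ‖expKernel 1 x‖ ^ 2 / ((1 : ℕ) : ℝ) ^ 2 = 1 := by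
        simp [expKernel, unitExp_zero]
      rw [h3] at h2
      have h4 : 1 / nint x ≤ 8 := by
        rw [div_le_iff₀ hy]
        linarith
      linarith
    · set z := 1 / (8 * nint x) with hz
      have hz1 : 1 ≤ z := by
        rw [hz, le_div_iff₀ (by positivity)]
        linarith
      have hzm : z < m := by
        rw [hz, div_lt_iff₀ (by positivity)]
        linarith
      have hfl := Nat.floor_le (zero_le_one.trans hz1)
      have hK := key ⌊z⌋₊ (by exact_mod_cast (hfl.trans hzm.le)) (by
        rw [hz, le_div_iff₀ (by positivity)] at hfl
        linarith)
      have h5 : z / 2 ≤ ⌊z⌋₊ := by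
        have h6 := Nat.lt_floor_add_one z
        have h7 : (1 : ℝ) ≤ ⌊z⌋₊ := by exact_mod_cast Nat.le_floor (by exact_mod_cast hz1)
        linarith
      have h9 : 1 / nint x = 8 * z := by
        rw [hz]
        field_simp
      linarith

lemma sum_one_div_sqrt_le (H : ℕ) :
    ∑ d ∈ range H, 1 / √((d + 1 : ℕ) : ℝ) ≤ 2 * √(H : ℝ) := by
  induction H with
  | zero => simp
  | succ H ih =>
    rw [sum_range_succ]
    have hs : 0 < √((H + 1 : ℕ) : ℝ) := Real.sqrt_pos.2 (by positivity)
    have h1 : √((H + 1 : ℕ) : ℝ) * √((H + 1 : ℕ) : ℝ) = H + 1 := by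
      rw [Real.mul_self_sqrt (by positivity)]
      push_cast
      rfl
    have h2 : √(H : ℝ) * √(H : ℝ) = H := Real.mul_self_sqrt (by positivity)
    have h3 : 1 / √((H + 1 : ℕ) : ℝ) ≤ 2 * √((H + 1 : ℕ) : ℝ) - 2 * √(H : ℝ) := by
      rw [div_le_iff₀ hs]
      nlinarith [sq_nonneg (√((H + 1 : ℕ) : ℝ) - √(H : ℝ))]
    linarith

theorem sum_min_npow_gamma_bound (γ : ℝ) (hγ1 : 0 < γ) (hγ2 : γ < 1) :
    ∃ C > 0, ∀ (M N₁ : ℝ), 2 ≤ M → 2 ≤ N₁ →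
      ∑ n ∈ Finset.Ioc ⌊N₁⌋₊ ⌊2 * N₁⌋₊,
        (if nint ((n : ℝ) ^ γ) = 0 then (1 : ℝ)
         else min 1 (1 / (M * nint ((n : ℝ) ^ γ)))) ≤
      C * (N₁ * M ^ (-(1 : ℝ)) + N₁ ^ (γ / 2) * M ^ ((1 : ℝ) / 2) +
        N₁ ^ (1 - γ / 2) * M ^ (-(1 : ℝ) / 2)) * Real.log M := by
  obtain ⟨C, hC, hexp⟩ := norm_sum_unitExp_rpow_le hγ1 hγ2
  refine ⟨64 * 3 * (2 + 4 * C), by positivity, fun M N hM hN ↦ ?_⟩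
  have hM0 : 0 < M := by linarith
  have hN0 : 0 < N := by linarith
  set T := Ioc ⌊N⌋₊ ⌊2 * N⌋₊ with hT
  set X := N ^ (γ / 2) with hX
  set Y := N ^ (1 - γ / 2) with hY
  have hX0 : 0 < X := by positivity
  have hY0 : 0 < Y := by positivity
  have hsM : 0 < √M := Real.sqrt_pos.2 hM0
  have hssM : √M * √M = M := Real.mul_self_sqrt hM0.le
  have hcard : (#T : ℝ) ≤ 2 * N := by
    rw [hT, Nat.card_Ioc]
    exact (Nat.cast_le.2 (Nat.sub_le _ _)).trans (Nat.floor_le (by linarith))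
  set B := 2 * N + 2 * (C * (M * √M * X + 2 * √M * Y)) with hB
  have hB0 : 0 < B := by positivity
  have hker : ∀ H ∈ Icc 1 ⌊M⌋₊,
      (∑ n ∈ T, ‖expKernel H ((n : ℝ) ^ γ)‖ ^ 2) / (H : ℝ) ^ 2 ≤ (H : ℝ)⁻¹ * B := by
    intro H hH
    rw [mem_Icc] at hH
    have hH0 : (0 : ℝ) < H := by exact_mod_cast hH.1
    have hHM : (H : ℝ) ≤ M := (Nat.cast_le.2 hH.2).trans (Nat.floor_le hM0.le)
    have h1 : ∑ d ∈ range H, ‖∑ n ∈ T, unitExp (((d + 1 : ℕ) : ℝ) * (n : ℝ) ^ γ)‖ ≤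
        C * (M * √M * X + 2 * √M * Y) := by
      have h2 : ∀ d ∈ range H, ‖∑ n ∈ T, unitExp (((d + 1 : ℕ) : ℝ) * (n : ℝ) ^ γ)‖ ≤
          C * (√M * X + Y * (1 / √((d + 1 : ℕ) : ℝ))) := by
        intro d hd
        refine (hexp N _ hN (by positivity)).trans ?_
        have h3 : √((d + 1 : ℕ) : ℝ) ≤ √M := by
          refine Real.sqrt_le_sqrt (le_trans ?_ hHM)
          exact_mod_cast mem_range.1 hd
        rw [mul_one_div]
        gcongr
      refine (sum_le_sum h2).trans ?_
      rw [← mul_sum, sum_add_distrib, sum_const, card_range, nsmul_eq_mul]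
      have h4 := (sum_one_div_sqrt_le H).trans
        (mul_le_mul_of_nonneg_left (Real.sqrt_le_sqrt hHM) zero_le_two)
      refine mul_le_mul_of_nonneg_left (add_le_add ?_ ?_) hC.le
      · rw [mul_assoc M]
        gcongr
      · rw [mul_comm (2 * √M), ← mul_sum]
        exact mul_le_mul_of_nonneg_left h4 hY0.le
    have h5 := sum_norm_expKernel_sq_le T (fun n ↦ (n : ℝ) ^ γ) H
    rw [div_le_iff₀ (by positivity)]
    refine h5.trans ?_
    have h6 : (H : ℝ)⁻¹ * B * (H : ℝ) ^ 2 = H * B := by field_simp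
    rw [h6]
    gcongr
    rw [hB]
    linarith
  have hharm : ∑ H ∈ Icc 1 ⌊M⌋₊, (H : ℝ)⁻¹ ≤ 1 + Real.log M := by
    have := harmonic_floor_le_one_add_log M (by linarith)
    rw [harmonic_eq_sum_Icc] at this
    push_cast at this
    exact this
  have hlog : 1 + Real.log M ≤ 3 * Real.log M := by
    have h1 := Real.log_two_gt_d9
    have h2 := Real.log_le_log two_pos hM
    linarith
  have hlog0 : 0 < Real.log M := Real.log_pos (by linarith)
  calc _ ≤ ∑ n ∈ T, 64 / M * ∑ H ∈ Icc 1 ⌊M⌋₊, ‖expKernel H ((n : ℝ) ^ γ)‖ ^ 2 / (H : ℝ) ^ 2 :=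
        sum_le_sum fun n _ ↦ min_inv_nint_le_sum_expKernel hM _
    _ = 64 / M * ∑ H ∈ Icc 1 ⌊M⌋₊,
          (∑ n ∈ T, ‖expKernel H ((n : ℝ) ^ γ)‖ ^ 2) / (H : ℝ) ^ 2 := by
        rw [← mul_sum, sum_comm]
        simp_rw [sum_div]
    _ ≤ 64 / M * ∑ H ∈ Icc 1 ⌊M⌋₊, (H : ℝ)⁻¹ * B := by gcongr with H hH; exact hker H hH
    _ ≤ 64 / M * ((3 * Real.log M) * B) := by
        rw [← sum_mul]
        gcongr
        exact hharm.trans hlog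
    _ = 64 * 3 * (B / M) * Real.log M := by ring
    _ ≤ _ := by
        rw [mul_assoc (64 * 3 : ℝ) (2 + 4 * C)]
        gcongr
        have r1 : M ^ (-(1 : ℝ)) = 1 / M := by rw [Real.rpow_neg_one, one_div]
        have r2 : M ^ ((1 : ℝ) / 2) = √M := (Real.sqrt_eq_rpow M).symm
        have r3 : M ^ (-(1 : ℝ) / 2) = 1 / √M := by
          rw [neg_div, Real.rpow_neg hM0.le, r2, one_div]
        rw [r1, r2, r3]
        have r4 : B / M = 2 * (N * (1 / M)) + 2 * C * (X * √M) + 4 * C * (Y * (1 / √M)) := by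
          have r5 : √M / M = 1 / √M := by rw [div_eq_div_iff hM0.ne' hsM.ne', hssM, one_mul]
          rw [hB, ← r5]
          field_simp
          ring
        rw [r4]
        have p1 : 0 < N * (1 / M) := by positivity
        have p2 : 0 < X * √M := by positivity
        have p3 : 0 < Y * (1 / √M) := by positivity
        nlinarith [mul_pos hC p1, mul_pos hC p2, mul_pos hC p3]
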